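/- For every odd n ≥ 1, the maximum number ν(K_n) of pairwise edge-disjoint triangles in the complete graph K_n satisfies ν(K_n) ≥ (1/3)·(C(n,2) − 4). -/

import Mathlib

open Finset SimpleGraph

/-- A triangle packing of a graph `G`: a finite set of triangles (3-cliques) of `G`
that are pairwise edge-disjoint (any two distinct triangles share at most one vertex). -/
def IsTrianglePacking {V : Type*} [DecidableEq V] (G : SimpleGraph V)
    (P : Finset (Finset V)) : Prop :=
  (∀ t ∈ P, G.IsNClique 3 t) ∧
    ∀ t₁ ∈ P, ∀ t₂ ∈ P, t₁ ≠ t₂ → (t₁ ∩ t₂).card ≤ 1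

/-- `nu G` is the maximum cardinality of a triangle packing of `G`. -/
noncomputable def nu {V : Type*} [Fintype V] [DecidableEq V] (G : SimpleGraph V) : ℕ :=
  sSup {n | ∃ P : Finset (Finset V), IsTrianglePacking G P ∧ P.card = n}

/-- A triangle hitting set of `G`: a set of edges of `G` whose removal
results in a triangle-free graph. -/
def IsTriangleHitting {V : Type*} (G : SimpleGraph V) (T : Finset (Sym2 V)) : Prop :=
  ↑T ⊆ G.edgeSet ∧ (G.deleteEdges ↑T).CliqueFree 3

/-- `tau G` is the minimum cardinality of a triangle hitting set of `G`. -/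
noncomputable def tau {V : Type*} [Fintype V] [DecidableEq V] (G : SimpleGraph V) : ℕ :=
  sInf {n | ∃ T : Finset (Sym2 V), IsTriangleHitting G T ∧ T.card = n}

/-- A triangle packing of the complete graph on any type with `n` elements gives a lower bound
for `nu` of the complete graph on `Fin n`. -/
theorem IsTrianglePacking.card_le_nu {V : Type*} [Fintype V] [DecidableEq V] {n : ℕ}
    (hV : Fintype.card V = n) {P : Finset (Finset V)}
    (hP : IsTrianglePacking (⊤ : SimpleGraph V) P) :
    P.card ≤ nu (⊤ : SimpleGraph (Fin n)) := by
  have e : V ≃ Fin n := Fintype.equivFinOfCardEq hV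
  refine le_csSup ⟨Fintype.card (Finset (Fin n)), ?_⟩
    ⟨P.map (mapEmbedding e.toEmbedding).toEmbedding, ⟨?_, ?_⟩, card_map _⟩
  · rintro _ ⟨Q, -, rfl⟩
    exact card_le_univ Q
  · intro t ht
    obtain ⟨s, hs, rfl⟩ := mem_map.1 ht
    have h3 := (hP.1 s hs).card_eq
    refine ⟨fun x _ y _ hxy => hxy, ?_⟩
    simpa using h3
  · intro t₁ h₁ t₂ h₂ hne
    obtain ⟨s₁, hs₁, rfl⟩ := mem_map.1 h₁
    obtain ⟨s₂, hs₂, rfl⟩ := mem_map.1 h₂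
    have h := hP.2 s₁ hs₁ s₂ hs₂ (fun h => hne (by rw [h]))
    simpa [← map_inter] using h

/-- A family of triples covering all pairs outside `D`, with no more triples than the number of
pairs allows, covers every pair at most once. -/
theorem choose_two_le_nu_of_cover {V : Type*} [Fintype V] [DecidableEq V] {n d : ℕ}
    (hV : Fintype.card V = n) (P D : Finset (Finset V)) (hD : D.card ≤ d)
    (h3 : ∀ t ∈ P, t.card = 3) (hcard : 3 * P.card + d ≤ n.choose 2)
    (hcov : ∀ a b : V, a ≠ b → {a, b} ∈ D ∨ ∃ t ∈ P, a ∈ t ∧ b ∈ t) :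
    n.choose 2 ≤ 3 * nu (⊤ : SimpleGraph (Fin n)) + d := by
  have hall : n.choose 2 ≤ (P.biUnion (powersetCard 2)).card + d := by
    calc n.choose 2 = (powersetCard 2 (univ : Finset V)).card := by
          rw [card_powersetCard, card_univ, hV]
      _ ≤ (P.biUnion (powersetCard 2) ∪ D).card := by
          refine card_le_card fun s hs => ?_
          obtain ⟨a, b, hab, rfl⟩ := card_eq_two.1 (mem_powersetCard.1 hs).2
          rcases hcov a b hab with h | ⟨t, ht, ha, hb⟩
          · exact mem_union_right _ h
          · refine mem_union_left _
              (mem_biUnion.2 ⟨t, ht, mem_powersetCard.2 ⟨?_, card_pair hab⟩⟩)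
            simp [insert_subset_iff, ha, hb]
      _ ≤ _ := (card_union_le _ _).trans (by omega)
  have hsum : ∀ Q ⊆ P, (Q.biUnion (powersetCard 2)).card ≤ 3 * Q.card := fun Q hQ => by
    rw [mul_comm]
    exact card_biUnion_le_card_mul _ _ _ fun t ht => by rw [card_powersetCard, h3 t (hQ ht)]; rfl
  have hP : IsTrianglePacking (⊤ : SimpleGraph V) P := by
    refine ⟨fun t ht => ⟨fun x _ y _ hxy => hxy, h3 t ht⟩, fun t₁ h₁ t₂ h₂ hne => ?_⟩
    by_contra! hlt
    obtain ⟨s, hs, hs2⟩ := exists_subset_card_eq (Nat.succ_le_of_lt hlt)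
    have hs1 : s ∈ powersetCard 2 t₁ := mem_powersetCard.2 ⟨hs.trans inter_subset_left, hs2⟩
    have hs2 : s ∈ powersetCard 2 t₂ := mem_powersetCard.2 ⟨hs.trans inter_subset_right, hs2⟩
    have hsub : P.biUnion (powersetCard 2) ⊆
        (powersetCard 2 t₁).erase s ∪ (P.erase t₁).biUnion (powersetCard 2) := by
      intro r hr
      obtain ⟨t, ht, hrt⟩ := mem_biUnion.1 hr
      by_cases hrs : r = s
      · subst hrs
        exact mem_union_right _ (mem_biUnion.2 ⟨t₂, mem_erase.2 ⟨hne.symm, h₂⟩, hs2⟩)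
      · by_cases htt : t = t₁
        · subst htt
          exact mem_union_left _ (mem_erase.2 ⟨hrs, hrt⟩)
        · exact mem_union_right _ (mem_biUnion.2 ⟨t, mem_erase.2 ⟨htt, ht⟩, hrt⟩)
    have hle := (card_le_card hsub).trans (card_union_le _ _)
    have hrest := hsum _ (erase_subset t₁ P)
    have hpos : 0 < P.card := card_pos.2 ⟨t₁, h₁⟩
    rw [card_erase_of_mem hs1, card_powersetCard, h3 t₁ h₁, show Nat.choose 3 2 = 3 from rfl] at hle
    rw [card_erase_of_mem h₁] at hrest
    omega
  have h1 := hsum P subset_rfl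
  have h2 := hP.card_le_nu hV
  omega

/-- The triples `{(a, i), (b, i), (a ∘ b, i + 1)}` with `a ≠ b`, for a commutative operation `∘`
depending on the level `i`, on the point set `G × ZMod 3` extended by a set `E`. -/
def mixedTriples {G : Type*} (E : Type*) [Fintype G] [DecidableEq G] [DecidableEq E]
    (op : ZMod 3 → G → G → G) (hop : ∀ i a b, op i a b = op i b a) :
    Finset (Finset (G × ZMod 3 ⊕ E)) :=
  univ.image fun p : ZMod 3 × {z : Sym2 G // ¬ z.IsDiag} =>
    Sym2.lift ⟨fun a b => {Sum.inl (a, p.1), Sum.inl (b, p.1), Sum.inl (op p.1 a b, p.1 + 1)},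
      fun a b => by
        change ({_, _, _} : Finset _) = {_, _, _}
        rw [hop, Finset.insert_comm]⟩ p.2.1

section mixedTriples

variable {G E : Type*} [Fintype G] [DecidableEq G] [DecidableEq E]
  {op : ZMod 3 → G → G → G} {hop : ∀ i a b, op i a b = op i b a}

theorem mem_mixedTriples (t : Finset (G × ZMod 3 ⊕ E)) :
    t ∈ mixedTriples E op hop ↔ ∃ i a b, a ≠ b ∧
      t = {Sum.inl (a, i), Sum.inl (b, i), Sum.inl (op i a b, i + 1)} := by
  constructor
  · intro h
    obtain ⟨⟨i, z, hz⟩, -, rfl⟩ := mem_image.1 h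
    induction z using Sym2.ind with
    | _ a b => exact ⟨i, a, b, by simpa using hz, rfl⟩
  · rintro ⟨i, a, b, hab, rfl⟩
    exact mem_image.2 ⟨(i, ⟨s(a, b), by simpa using hab⟩), mem_univ _, rfl⟩

theorem card_mixedTriples_le :
    (mixedTriples E op hop).card ≤ 3 * (Fintype.card G).choose 2 := by
  refine card_image_le.trans ?_
  rw [card_univ, Fintype.card_prod, ZMod.card, Sym2.card_subtype_not_diag]

theorem card_of_mem_mixedTriples {t : Finset (G × ZMod 3 ⊕ E)}
    (ht : t ∈ mixedTriples E op hop) : t.card = 3 := by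
  obtain ⟨i, a, b, hab, rfl⟩ := (mem_mixedTriples t).1 ht
  rw [card_eq_three]
  exact ⟨_, _, _, by simpa using hab, by simp, by simp, rfl⟩

/-- To cover all pairs of `G × ZMod 3 ⊕ E` by the mixed triples and further triples, it suffices to
consider the pairs `(a, i), (a ∘ a, i + 1)` and the pairs meeting `E`. -/
theorem cover_of_mixedTriples (hsurj : ∀ i a c, ∃ b, op i a b = c)
    (P D : Finset (Finset (G × ZMod 3 ⊕ E))) (hP : mixedTriples E op hop ⊆ P)
    (hdiag : ∀ i a, {Sum.inl (a, i), Sum.inl (op i a a, i + 1)} ∈ D ∨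
      ∃ t ∈ P, Sum.inl (a, i) ∈ t ∧ Sum.inl (op i a a, i + 1) ∈ t)
    (hinf : ∀ e a i, {Sum.inl (a, i), Sum.inr e} ∈ D ∨
      ∃ t ∈ P, Sum.inl (a, i) ∈ t ∧ Sum.inr e ∈ t)
    (hE : ∀ e f, e ≠ f → {Sum.inr e, Sum.inr f} ∈ D ∨
      ∃ t ∈ P, Sum.inr e ∈ t ∧ Sum.inr f ∈ t)
    (x y : G × ZMod 3 ⊕ E) (hxy : x ≠ y) : {x, y} ∈ D ∨ ∃ t ∈ P, x ∈ t ∧ y ∈ t := by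
  have hnext : ∀ i a c, {Sum.inl (a, i), Sum.inl (c, i + 1)} ∈ D ∨
      ∃ t ∈ P, Sum.inl (a, i) ∈ t ∧ Sum.inl (c, i + 1) ∈ t := by
    intro i a c
    obtain ⟨b, rfl⟩ := hsurj i a c
    by_cases hab : a = b
    · subst hab
      exact hdiag i a
    · exact Or.inr ⟨_, hP ((mem_mixedTriples _).2 ⟨i, a, b, hab, rfl⟩), by simp, by simp⟩
  rcases x with ⟨a, i⟩ | e <;> rcases y with ⟨c, j⟩ | f
  · have hlevel : ∀ i j : ZMod 3, j = i ∨ j = i + 1 ∨ i = j + 1 := by decide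
    rcases hlevel i j with rfl | rfl | rfl
    · have hac : a ≠ c := by
        rintro rfl
        exact hxy rfl
      exact Or.inr ⟨_, hP ((mem_mixedTriples _).2 ⟨j, a, c, hac, rfl⟩), by simp, by simp⟩
    · exact hnext i a c
    · rw [Finset.pair_comm]
      simpa only [and_comm] using hnext j c a
  · exact hinf f a i
  · rw [Finset.pair_comm]
    simpa only [and_comm] using hinf e c j
  · exact hE e f (fun h => hxy (by rw [h]))

end mixedTriples

theorem two_mul_choose_two (n : ℕ) : 2 * n.choose 2 = n * (n - 1) := by
  rw [Nat.choose_two_right, Nat.mul_div_cancel' (Nat.even_mul_pred_self n).two_dvd]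

theorem zmod_three_cases (i : ZMod 3) : i = 0 ∨ i = 1 ∨ i = 2 := by
  decide +revert

theorem one_add_one_zmod_three : (1 + 1 : ZMod 3) = 2 := rfl

theorem two_add_one_zmod_three : (2 + 1 : ZMod 3) = 0 := rfl

theorem neg_one_zmod_three : (-1 : ZMod 3) = 2 := rfl

theorem two_sub_one_zmod_three : (2 - 1 : ZMod 3) = 1 := rfl

theorem two_ne_one_zmod_three : (2 : ZMod 3) ≠ 1 := by decide

theorem zero_ne_two_zmod_three : (0 : ZMod 3) ≠ 2 := by decide

/-- The midpoint of two elements of `ZMod (2 * t + 1)`. -/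
def midpointZMod (t : ℕ) (a b : ZMod (2 * t + 1)) : ZMod (2 * t + 1) := (t + 1) * (a + b)

theorem midpointZMod_comm (t : ℕ) (a b : ZMod (2 * t + 1)) :
    midpointZMod t a b = midpointZMod t b a := by
  rw [midpointZMod, midpointZMod, add_comm a]

theorem two_mul_half_zmod (t : ℕ) : (2 * (t + 1) : ZMod (2 * t + 1)) = 1 := by
  have h := ZMod.natCast_self (2 * t + 1)
  push_cast at h
  linear_combination h

theorem midpointZMod_self (t : ℕ) (a : ZMod (2 * t + 1)) : midpointZMod t a a = a := by
  rw [midpointZMod]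
  linear_combination a * two_mul_half_zmod t

theorem midpointZMod_reflect (t : ℕ) (a c : ZMod (2 * t + 1)) :
    midpointZMod t a (2 * c - a) = c := by
  rw [midpointZMod]
  linear_combination c * two_mul_half_zmod t

/-- Bose's construction of Steiner triple systems. -/
theorem choose_two_le_nu_six_mul_add_three (t : ℕ) :
    (6 * t + 3).choose 2 ≤ 3 * nu (⊤ : SimpleGraph (Fin (6 * t + 3))) := by
  let M := mixedTriples (G := ZMod (2 * t + 1)) Empty (fun _ => midpointZMod t)
    (fun _ => midpointZMod_comm t)
  let T : Finset (Finset (ZMod (2 * t + 1) × ZMod 3 ⊕ Empty)) :=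
    univ.image fun a : ZMod (2 * t + 1) => {Sum.inl (a, 0), Sum.inl (a, 1), Sum.inl (a, 2)}
  have hT : ∀ a : ZMod (2 * t + 1), {Sum.inl (a, 0), Sum.inl (a, 1), Sum.inl (a, 2)} ∈ T := fun a =>
    mem_image_of_mem _ (mem_univ a)
  refine choose_two_le_nu_of_cover (V := ZMod (2 * t + 1) × ZMod 3 ⊕ Empty) (d := 0) ?_ (M ∪ T) ∅
    le_rfl ?_ ?_
    (cover_of_mixedTriples (fun _ a c => ⟨_, midpointZMod_reflect t a c⟩) _ _ subset_union_left
      ?_ ?_ ?_)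
  · simp [ZMod.card]
    ring
  · intro s hs
    rcases mem_union.1 hs with hs | hs
    · exact card_of_mem_mixedTriples hs
    · obtain ⟨a, -, rfl⟩ := mem_image.1 hs
      exact card_eq_three.2 ⟨_, _, _, by simp, by simp; decide, by simp; decide, rfl⟩
  · have h1 : M.card ≤ _ := card_mixedTriples_le
    have h2 : T.card ≤ _ := card_image_le
    rw [ZMod.card] at h1
    rw [card_univ, ZMod.card] at h2
    have h3 := card_union_le M T
    have h4 := two_mul_choose_two (2 * t + 1)
    have h5 := two_mul_choose_two (6 * t + 3)
    simp only [Nat.add_sub_cancel, show 6 * t + 3 - 1 = 6 * t + 2 by omega] at h4 h5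
    nlinarith
  · intro i a
    refine Or.inr ⟨_, mem_union_right _ (hT a), ?_⟩
    rw [midpointZMod_self]
    rcases zmod_three_cases i with rfl | rfl | rfl <;>
        simp [one_add_one_zmod_three, two_add_one_zmod_three]
  · exact fun e => e.elim
  · exact fun e => e.elim

/-- A bijection of `ZMod (2 * t)`, halving the even elements, such that `a, b ↦ skolemHalf t (a + b)`
is a half-idempotent commutative quasigroup. -/
def skolemHalf (t : ℕ) (s : ZMod (2 * t)) : ZMod (2 * t) :=
  if Even s.val then ((s.val / 2 : ℕ) : ZMod (2 * t)) else ((t + s.val / 2 : ℕ) : ZMod (2 * t))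

theorem skolemHalf_surjective {t : ℕ} (ht : 0 < t) : Function.Surjective (skolemHalf t) := by
  have : NeZero (2 * t) := ⟨by omega⟩
  intro c
  have hc := ZMod.val_lt c
  by_cases h : c.val < t
  · refine ⟨((2 * c.val : ℕ) : ZMod (2 * t)), ?_⟩
    rw [skolemHalf, ZMod.val_natCast_of_lt (by omega), if_pos (by simp),
      Nat.mul_div_cancel_left _ two_pos, ZMod.natCast_zmod_val]
  · refine ⟨((2 * (c.val - t) + 1 : ℕ) : ZMod (2 * t)), ?_⟩
    rw [skolemHalf, ZMod.val_natCast_of_lt (by omega), if_neg (by simp),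
      show t + (2 * (c.val - t) + 1) / 2 = c.val by omega, ZMod.natCast_zmod_val]

theorem skolemHalf_natCast_add_self {t k : ℕ} (hk : k < t) :
    skolemHalf t ((k : ZMod (2 * t)) + k) = k := by
  rw [skolemHalf, ← Nat.cast_add, ZMod.val_natCast_of_lt (by omega), if_pos ⟨k, rfl⟩,
    show (k + k) / 2 = k by omega]

theorem skolemHalf_natCast_add_half_add_self {t k : ℕ} (hk : k < t) :
    skolemHalf t (((t + k : ℕ) : ZMod (2 * t)) + (t + k : ℕ)) = k := by
  rw [← skolemHalf_natCast_add_self hk]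
  congr 1
  have h := ZMod.natCast_self (2 * t)
  push_cast at h ⊢
  linear_combination h

theorem ZMod.exists_natCast_lt_half {t : ℕ} (ht : 0 < t) (a : ZMod (2 * t)) :
    ∃ k < t, a = (k : ZMod (2 * t)) ∨ a = ((t + k : ℕ) : ZMod (2 * t)) := by
  have : NeZero (2 * t) := ⟨by omega⟩
  have ha := ZMod.val_lt a
  by_cases h : a.val < t
  · exact ⟨a.val, h, Or.inl (ZMod.natCast_zmod_val a).symm⟩
  · refine ⟨a.val - t, by omega, Or.inr ?_⟩
    rw [show t + (a.val - t) = a.val by omega, ZMod.natCast_zmod_val]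

/-- Skolem's construction of Steiner triple systems. -/
theorem choose_two_le_nu_six_mul_add_one {t : ℕ} (ht : 0 < t) :
    (6 * t + 1).choose 2 ≤ 3 * nu (⊤ : SimpleGraph (Fin (6 * t + 1))) := by
  have : NeZero (2 * t) := ⟨by omega⟩
  let M := mixedTriples (G := ZMod (2 * t)) Unit (fun _ a b => skolemHalf t (a + b))
    (fun _ a b => by rw [add_comm a])
  let T : Finset (Finset (ZMod (2 * t) × ZMod 3 ⊕ Unit)) :=
    (range t).image fun k : ℕ =>
      {Sum.inl ((k : ZMod (2 * t)), 0), Sum.inl ((k : ZMod (2 * t)), 1),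
        Sum.inl ((k : ZMod (2 * t)), 2)}
  let S : Finset (Finset (ZMod (2 * t) × ZMod 3 ⊕ Unit)) :=
    (range t ×ˢ univ).image fun p : ℕ × ZMod 3 =>
      {Sum.inl (((t + p.1 : ℕ) : ZMod (2 * t)), p.2),
        Sum.inl ((p.1 : ZMod (2 * t)), p.2 + 1), Sum.inr ()}
  have hT : ∀ k < t,
      {Sum.inl ((k : ZMod (2 * t)), 0), Sum.inl ((k : ZMod (2 * t)), 1),
        Sum.inl ((k : ZMod (2 * t)), 2)} ∈ T :=
    fun k hk => mem_image_of_mem _ (mem_range.2 hk)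
  have hS : ∀ k < t, ∀ i : ZMod 3,
      {Sum.inl (((t + k : ℕ) : ZMod (2 * t)), i),
        Sum.inl ((k : ZMod (2 * t)), i + 1), Sum.inr ()} ∈ S :=
    fun k hk i => mem_image.2 ⟨(k, i), by simpa using hk, rfl⟩
  refine choose_two_le_nu_of_cover (V := ZMod (2 * t) × ZMod 3 ⊕ Unit) (d := 0) ?_ (M ∪ (T ∪ S)) ∅
    le_rfl ?_ ?_ (cover_of_mixedTriples (fun _ a c => ?_) _ _ subset_union_left ?_ ?_ ?_)
  · simp [ZMod.card]
    ring
  · intro s hs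
    rcases mem_union.1 hs with hs | hs
    · exact card_of_mem_mixedTriples hs
    rcases mem_union.1 hs with hs | hs
    · obtain ⟨a, -, rfl⟩ := mem_image.1 hs
      exact card_eq_three.2 ⟨_, _, _, by simp, by simp; decide, by simp; decide, rfl⟩
    · obtain ⟨⟨k, i⟩, -, rfl⟩ := mem_image.1 hs
      exact card_eq_three.2 ⟨_, _, _, by simp, by simp, by simp, rfl⟩
  · have h1 : M.card ≤ _ := card_mixedTriples_le
    have h2 : T.card ≤ _ := card_image_le
    have h3 : S.card ≤ _ := card_image_le
    rw [ZMod.card] at h1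
    rw [card_range] at h2
    rw [card_product, card_range, card_univ, ZMod.card] at h3
    have h4 := card_union_le M (T ∪ S)
    have h5 := card_union_le T S
    have h6 := two_mul_choose_two (2 * t)
    have h7 := two_mul_choose_two (6 * t + 1)
    obtain ⟨r, rfl⟩ : ∃ r, t = r + 1 := ⟨t - 1, by omega⟩
    simp only [show 2 * (r + 1) - 1 = 2 * r + 1 by omega, Nat.add_sub_cancel] at h6 h7
    nlinarith
  · obtain ⟨s, hs⟩ := skolemHalf_surjective ht c
    exact ⟨s - a, by rw [add_sub_cancel, hs]⟩
  · intro i a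
    obtain ⟨k, hk, rfl | rfl⟩ := ZMod.exists_natCast_lt_half ht a
    · refine Or.inr ⟨_, mem_union_right _ (mem_union_left _ (hT k hk)), ?_⟩
      rw [skolemHalf_natCast_add_self hk]
      rcases zmod_three_cases i with rfl | rfl | rfl <;>
        simp [one_add_one_zmod_three, two_add_one_zmod_three]
    · refine Or.inr ⟨_, mem_union_right _ (mem_union_right _ (hS k hk i)), ?_⟩
      rw [skolemHalf_natCast_add_half_add_self hk]
      simp
  · intro e a i
    obtain ⟨k, hk, rfl | rfl⟩ := ZMod.exists_natCast_lt_half ht a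
    · exact Or.inr ⟨_, mem_union_right _ (mem_union_right _ (hS k hk (i - 1))), by simp, by simp⟩
    · exact Or.inr ⟨_, mem_union_right _ (mem_union_right _ (hS k hk i)), by simp, by simp⟩
  · exact fun e f h => (h rfl).elim

theorem ZMod.eq_zero_or_exists_natCast_lt (t : ℕ) (a : ZMod (2 * t + 1)) :
    a = 0 ∨ ∃ k < t, a = ((k + 1 : ℕ) : ZMod (2 * t + 1)) ∨
      a = -((k + 1 : ℕ) : ZMod (2 * t + 1)) := by
  have ha := ZMod.val_lt a
  rcases Nat.eq_zero_or_pos a.val with h0 | h0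
  · exact Or.inl ((ZMod.val_eq_zero a).1 h0)
  right
  by_cases h : a.val ≤ t
  · refine ⟨a.val - 1, by omega, Or.inl ?_⟩
    rw [show a.val - 1 + 1 = a.val by omega, ZMod.natCast_zmod_val]
  · refine ⟨2 * t - a.val, by omega, Or.inr ?_⟩
    have h1 : ((2 * t - a.val + 1 + a.val : ℕ) : ZMod (2 * t + 1)) = 0 := by
      rw [show 2 * t - a.val + 1 + a.val = 2 * t + 1 by omega, ZMod.natCast_self]
    rw [Nat.cast_add, ZMod.natCast_zmod_val] at h1
    linear_combination h1

/-- The midpoint operation, negated at the last level. -/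
def twistedMidpoint (t : ℕ) (i : ZMod 3) (a b : ZMod (2 * t + 1)) : ZMod (2 * t + 1) :=
  if i = 2 then -midpointZMod t a b else midpointZMod t a b

/-- The six edges of the hexagon
`(x, 0), (x, 1), (x, 2), (-x, 0), (-x, 1), (-x, 2)`, alternately joined to two further points. -/
def hexagonTriple {G : Type*} [Neg G] [DecidableEq G] (x : G) :
    ZMod 3 × Bool → Finset (G × ZMod 3 ⊕ Bool)
  | (i, e) =>
    let y := if (i = 1) = (e = true) then x else -x
    {Sum.inl (y, i), Sum.inl (if i = 2 then -y else y, i + 1), Sum.inr e}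

theorem exists_mem_hexagonTriple {G : Type*} [InvolutiveNeg G] [DecidableEq G] (x : G)
    (i : ZMod 3) (e : Bool) :
    ∃ j, Sum.inl (x, i) ∈ hexagonTriple x (j, e) := by
  by_cases h : (i = 1) = (e = true)
  · exact ⟨i, by simp [hexagonTriple, h]⟩
  · refine ⟨i - 1, ?_⟩
    rcases zmod_three_cases i with rfl | rfl | rfl <;> cases e <;>
      simp [hexagonTriple, neg_one_zmod_three, two_sub_one_zmod_three, two_add_one_zmod_three,
        two_ne_one_zmod_three, two_ne_one_zmod_three.symm, zero_ne_two_zmod_three,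
        one_add_one_zmod_three] at h ⊢

theorem exists_neg_mem_hexagonTriple {G : Type*} [InvolutiveNeg G] [DecidableEq G] (x : G)
    (i : ZMod 3) (e : Bool) :
    ∃ j, Sum.inl (-x, i) ∈ hexagonTriple x (j, e) := by
  by_cases h : (i = 1) = (e = true)
  · refine ⟨i - 1, ?_⟩
    rcases zmod_three_cases i with rfl | rfl | rfl <;> cases e <;>
      simp [hexagonTriple, neg_one_zmod_three, two_sub_one_zmod_three, two_add_one_zmod_three,
        two_ne_one_zmod_three, two_ne_one_zmod_three.symm, zero_ne_two_zmod_three,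
        one_add_one_zmod_three] at h ⊢
  · exact ⟨i, by simp [hexagonTriple, h]⟩

/-- A maximum triangle packing of the complete graph whose leave is a four-cycle. -/
theorem choose_two_le_nu_six_mul_add_five (t : ℕ) :
    (6 * t + 5).choose 2 ≤ 3 * nu (⊤ : SimpleGraph (Fin (6 * t + 5))) + 4 := by
  let M := mixedTriples (G := ZMod (2 * t + 1)) Bool (twistedMidpoint t)
    (fun i a b => by simp only [twistedMidpoint, midpointZMod_comm t a b])
  let H : Finset (Finset (ZMod (2 * t + 1) × ZMod 3 ⊕ Bool)) :=
    (range t ×ˢ univ).image fun p : ℕ × (ZMod 3 × Bool) =>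
      hexagonTriple (((p.1 + 1 : ℕ) : ZMod (2 * t + 1))) p.2
  let F : Finset (Finset (ZMod (2 * t + 1) × ZMod 3 ⊕ Bool)) :=
    {{Sum.inl (0, 0), Sum.inl (0, 1), Sum.inr false},
      {Sum.inl (0, 2), Sum.inr true, Sum.inr false}}
  let D : Finset (Finset (ZMod (2 * t + 1) × ZMod 3 ⊕ Bool)) :=
    {{Sum.inl (0, 1), Sum.inl (0, 2)}, {Sum.inl (0, 2), Sum.inl (0, 0)},
      {Sum.inl (0, 0), Sum.inr true}, {Sum.inl (0, 1), Sum.inr true}}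
  have hH : ∀ k < t, ∀ p, hexagonTriple (((k + 1 : ℕ) : ZMod (2 * t + 1))) p ∈ M ∪ (H ∪ F) :=
    fun k hk p => mem_union_right _ (mem_union_left _
      (mem_image.2 ⟨(k, p), by simpa using hk, rfl⟩))
  have hF : ∀ s ∈ F, s ∈ M ∪ (H ∪ F) := fun s hs => mem_union_right _ (mem_union_right _ hs)
  refine choose_two_le_nu_of_cover (V := ZMod (2 * t + 1) × ZMod 3 ⊕ Bool) (d := 4) ?_
    (M ∪ (H ∪ F)) D card_le_four ?_ ?_ (cover_of_mixedTriples (fun i a c => ?_) _ _ subset_union_left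
      ?_ ?_ ?_)
  · simp [ZMod.card]
    ring
  · intro s hs
    rcases mem_union.1 hs with hs | hs
    · exact card_of_mem_mixedTriples hs
    rcases mem_union.1 hs with hs | hs
    · obtain ⟨⟨k, i, e⟩, -, rfl⟩ := mem_image.1 hs
      exact card_eq_three.2 ⟨_, _, _, by simp, by simp, by simp, rfl⟩
    · rcases mem_insert.1 hs with rfl | hs
      · exact card_eq_three.2 ⟨_, _, _, by simp, by simp, by simp, rfl⟩
      · rw [mem_singleton.1 hs]
        exact card_eq_three.2 ⟨_, _, _, by simp, by simp, by simp, rfl⟩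
  · have h1 : M.card ≤ _ := card_mixedTriples_le
    have h2 : H.card ≤ _ := card_image_le
    have h3 : F.card ≤ 2 := card_le_two
    rw [ZMod.card] at h1
    rw [card_product, card_range, card_univ, Fintype.card_prod, ZMod.card, Fintype.card_bool] at h2
    have h4 := card_union_le M (H ∪ F)
    have h5 := card_union_le H F
    have h6 := two_mul_choose_two (2 * t + 1)
    have h7 := two_mul_choose_two (6 * t + 5)
    simp only [Nat.add_sub_cancel, show 6 * t + 5 - 1 = 6 * t + 4 by omega] at h6 h7
    nlinarith
  · by_cases hi : i = 2
    · exact ⟨2 * -c - a, by simp only [twistedMidpoint, if_pos hi, midpointZMod_reflect, neg_neg]⟩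
    · exact ⟨2 * c - a, by simp only [twistedMidpoint, if_neg hi, midpointZMod_reflect]⟩
  · intro i a
    simp only [twistedMidpoint, midpointZMod_self]
    rcases ZMod.eq_zero_or_exists_natCast_lt t a with rfl | ⟨k, hk, rfl | rfl⟩
    · rcases zmod_three_cases i with rfl | rfl | rfl
      · exact Or.inr ⟨_, hF _ (mem_insert_self _ _), by simp, by simp⟩
      · exact Or.inl (by simp [D, one_add_one_zmod_three])
      · exact Or.inl (by simp [D, two_add_one_zmod_three])
    · refine Or.inr ⟨_, hH k hk (i, decide (i = 1)), ?_, ?_⟩ <;> simp [hexagonTriple]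
    · refine Or.inr ⟨_, hH k hk (i, decide (i ≠ 1)), ?_, ?_⟩ <;>
        simp [hexagonTriple, -neg_add_rev]
  · intro e a i
    rcases ZMod.eq_zero_or_exists_natCast_lt t a with rfl | ⟨k, hk, rfl | rfl⟩
    · rcases zmod_three_cases i with rfl | rfl | rfl <;> cases e
      · exact Or.inr ⟨_, hF _ (mem_insert_self _ _), by simp, by simp⟩
      · exact Or.inl (by simp [D])
      · exact Or.inr ⟨_, hF _ (mem_insert_self _ _), by simp, by simp⟩
      · exact Or.inl (by simp [D])
      all_goals
        exact Or.inr ⟨_, hF _ (mem_insert_of_mem (mem_singleton_self _)), by simp, by simp⟩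
    · obtain ⟨j, hj⟩ := exists_mem_hexagonTriple (((k + 1 : ℕ) : ZMod (2 * t + 1))) i e
      exact Or.inr ⟨_, hH k hk (j, e), hj, by simp [hexagonTriple]⟩
    · obtain ⟨j, hj⟩ := exists_neg_mem_hexagonTriple (((k + 1 : ℕ) : ZMod (2 * t + 1))) i e
      exact Or.inr ⟨_, hH k hk (j, e), hj, by simp [hexagonTriple]⟩
  · intro e f hef
    refine Or.inr ⟨_, hF _ (mem_insert_of_mem (mem_singleton_self _)), ?_⟩
    cases e <;> cases f <;> simp_all

/-- For every odd `n ≥ 1`, `ν(K_n) ≥ (1/3)(C(n,2) - 4)`. -/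
theorem nu_completeGraph_ge_odd (n : ℕ) (hn : 1 ≤ n) (hodd : Odd n) :
    (nu (⊤ : SimpleGraph (Fin n)) : ℝ) ≥
      (1 / 3) * ((n.choose 2 : ℝ) - 4) := by
  suffices h : n.choose 2 ≤ 3 * nu (⊤ : SimpleGraph (Fin n)) + 4 by
    have h' : (n.choose 2 : ℝ) ≤ 3 * nu (⊤ : SimpleGraph (Fin n)) + 4 := by exact_mod_cast h
    linarith
  obtain ⟨k, rfl⟩ := hodd
  obtain ⟨t, rfl | rfl | rfl⟩ : ∃ t, k = 3 * t ∨ k = 3 * t + 1 ∨ k = 3 * t + 2 :=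
    ⟨k / 3, by omega⟩
  · rcases Nat.eq_zero_or_pos t with rfl | ht
    · simp
    · rw [show 2 * (3 * t) + 1 = 6 * t + 1 by ring]
      exact (choose_two_le_nu_six_mul_add_one ht).trans (Nat.le_add_right _ _)
  · rw [show 2 * (3 * t + 1) + 1 = 6 * t + 3 by ring]
    exact (choose_two_le_nu_six_mul_add_three t).trans (Nat.le_add_right _ _)
  · rw [show 2 * (3 * t + 2) + 1 = 6 * t + 5 by ring]
    exact choose_two_le_nu_six_mul_add_five t
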